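/- Define κ(a,b) := ⟨a,b⟩/(‖a‖·‖b‖), ρ(a,b) := ‖a‖/‖b‖ and φ(a,b) := (κ(a,b) − ρ(a,b))/√(1 − κ(a,b)²). Let the source be s = (−1, 0) and the detectors be d(θ) := s + 2cos θ·(cos θ, sin θ) for θ ∈ (−π/2, π/2) (these lie on the unit circle S¹). Then for every θ ∈ (−π/2, π/2) and every x in the open unit disk B₁(0) with x − s and d(θ) − s linearly independent, the vectors ∇ₓφ(x − s, d(θ) − s) and ∂_θ[∇ₓφ(x − s, d(θ) − s)] are linearly independent, i.e. det(∇ₓφ, ∂_θ∇ₓφ) ≠ 0. -/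

import Mathlib

open scoped RealInnerProductSpace

noncomputable def kappa (a b : EuclideanSpace ℝ (Fin 2)) : ℝ :=
  ⟪a, b⟫ / (‖a‖ * ‖b‖)

noncomputable def rho (a b : EuclideanSpace ℝ (Fin 2)) : ℝ :=
  ‖a‖ / ‖b‖

noncomputable def phi (a b : EuclideanSpace ℝ (Fin 2)) : ℝ :=
  (kappa a b - rho a b) / Real.sqrt (1 - (kappa a b) ^ 2)

noncomputable def vec2 (a b : ℝ) : EuclideanSpace ℝ (Fin 2) :=
  (WithLp.equiv 2 (Fin 2 → ℝ)).symm ![a, b]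

/-- Source at `s = (−1, 0)`. -/
noncomputable def src : EuclideanSpace ℝ (Fin 2) := vec2 (-1) 0

/-- Detector curve `d(θ) = s + 2 cos θ (cos θ, sin θ)` on the unit circle. -/
noncomputable def det' (θ : ℝ) : EuclideanSpace ℝ (Fin 2) :=
  src + (2 * Real.cos θ) • vec2 (Real.cos θ) (Real.sin θ)


lemma vec2_zero_aux (a b : ℝ) : vec2 a b 0 = a := by simp [vec2]

lemma vec2_one_aux (a b : ℝ) : vec2 a b 1 = b := by simp [vec2]

lemma phi_formula_aux (c s : ℝ) (hc : 0 < c) (hcs : c ^ 2 + s ^ 2 = 1) (a : EuclideanSpace ℝ (Fin 2))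
    (ε : ℝ) (hε : ε = 1 ∨ ε = -1) (hq : 0 < ε * (a 0 * s - a 1 * c)) :
    phi a ((2 * c) • vec2 c s) =
      ε * (2 * c * (a 0 * c + a 1 * s) - (a 0 ^ 2 + a 1 ^ 2)) /
        (2 * c * (a 0 * s - a 1 * c)) := by
  have hb : ‖(2 * c) • vec2 c s‖ = 2 * c := by
    rw [norm_smul, EuclideanSpace.norm_eq]
    simp [Fin.sum_univ_two, vec2_zero_aux, vec2_one_aux, hcs, abs_of_pos hc]
  have hin : ⟪a, (2 * c) • vec2 c s⟫ = 2 * c * (a 0 * c + a 1 * s) := by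
    rw [inner_smul_right]
    simp [PiLp.inner_apply, Fin.sum_univ_two, vec2_zero_aux, vec2_one_aux]
    left
    ring
  have hr2 : ‖a‖ ^ 2 = a 0 ^ 2 + a 1 ^ 2 := by
    rw [EuclideanSpace.norm_sq_eq]
    simp [Fin.sum_univ_two]
  have hε2 : ε ^ 2 = 1 := by rcases hε with h | h <;> simp [h]
  have hqne : a 0 * s - a 1 * c ≠ 0 := by
    intro h; simp [h] at hq
  have hr : 0 < ‖a‖ := by
    rw [norm_pos_iff]
    rintro rfl
    simp at hq
  have hsq : 1 - (2 * c * (a 0 * c + a 1 * s) / (‖a‖ * (2 * c))) ^ 2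
      = (ε * (a 0 * s - a 1 * c) / ‖a‖) ^ 2 := by
    field_simp
    rw [hr2, hε2]
    linear_combination (-(a 0 ^ 2 + a 1 ^ 2)) * hcs
  unfold phi kappa rho
  rw [hb, hin, hsq, Real.sqrt_sq (by positivity)]
  have hεne : ε ≠ 0 := by rintro rfl; simp at hε2
  rw [← hr2]
  field_simp
  rw [hε2]
  ring

lemma grad_formula_aux (c s : ℝ) (hc : 0 < c) (hcs : c ^ 2 + s ^ 2 = 1)
    (x : EuclideanSpace ℝ (Fin 2))
    (ε : ℝ) (hε : ε = 1 ∨ ε = -1) (hq : 0 < ε * ((x 0 + 1) * s - x 1 * c)) :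
    gradient (fun x' => phi (x' - src) ((2 * c) • vec2 c s)) x =
      (ε / (2 * c * ((x 0 + 1) * s - x 1 * c) ^ 2)) •
      vec2 ((2 * c * c - 2 * (x 0 + 1)) * ((x 0 + 1) * s - x 1 * c)
          - (2 * c * ((x 0 + 1) * c + x 1 * s) - ((x 0 + 1) ^ 2 + x 1 ^ 2)) * s)
        ((2 * c * s - 2 * x 1) * ((x 0 + 1) * s - x 1 * c)
          + (2 * c * ((x 0 + 1) * c + x 1 * s) - ((x 0 + 1) ^ 2 + x 1 ^ 2)) * c) := by
  have hqne : (x 0 + 1) * s - x 1 * c ≠ 0 := by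
    intro h; simp [h] at hq
  apply HasGradientAt.gradient
  have hev : (fun x' => phi (x' - src) ((2 * c) • vec2 c s)) =ᶠ[nhds x]
      fun x' => ε * (2 * c * ((x' 0 + 1) * c + x' 1 * s) - ((x' 0 + 1) ^ 2 + x' 1 ^ 2)) /
        (2 * c * ((x' 0 + 1) * s - x' 1 * c)) := by
    have hcont : Continuous fun x' : EuclideanSpace ℝ (Fin 2) =>
        ε * ((x' 0 + 1) * s - x' 1 * c) := by fun_prop
    filter_upwards [hcont.continuousAt.eventually (lt_mem_nhds hq)] with y hy
    have h0 : (y - src) 0 = y 0 + 1 := by simp [src, vec2_zero_aux]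
    have h1 : (y - src) 1 = y 1 := by simp [src, vec2_one_aux]
    rw [phi_formula_aux c s hc hcs _ ε hε (by rw [h0, h1]; exact hy), h0, h1]
  refine HasGradientAt.congr_of_eventuallyEq ?_ hev
  rw [hasGradientAt_iff_hasFDerivAt]
  have p0 : HasFDerivAt (fun y : EuclideanSpace ℝ (Fin 2) => y 0)
      (EuclideanSpace.proj 0 : EuclideanSpace ℝ (Fin 2) →L[ℝ] ℝ) x :=
    (EuclideanSpace.proj 0 : EuclideanSpace ℝ (Fin 2) →L[ℝ] ℝ).hasFDerivAt
  have p1 : HasFDerivAt (fun y : EuclideanSpace ℝ (Fin 2) => y 1)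
      (EuclideanSpace.proj 1 : EuclideanSpace ℝ (Fin 2) →L[ℝ] ℝ) x :=
    (EuclideanSpace.proj 1 : EuclideanSpace ℝ (Fin 2) →L[ℝ] ℝ).hasFDerivAt
  have u0 := p0.add_const 1
  have hN := ((((u0.mul_const c).add (p1.mul_const s)).const_mul (2 * c)).sub
    ((u0.pow 2).add (p1.pow 2))).const_mul ε
  have hD := ((u0.mul_const s).sub (p1.mul_const c)).const_mul (2 * c)
  have hDne : 2 * c * ((x 0 + 1) * s - x 1 * c) ≠ 0 := by positivity
  have hF := hN.mul ((hasDerivAt_inv hDne).comp_hasFDerivAt x hD)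
  refine hF.congr_fderiv ?_
  ext y
  simp [PiLp.inner_apply, Fin.sum_univ_two, vec2_zero_aux, vec2_one_aux]
  field_simp
  ring

/-- **Geometric content of Theorem 4 (sobolevtheoreml1).** In the circular scanning
geometry with source `s = (−1,0)` and detectors `d(θ) = s + 2 cos θ (cos θ, sin θ)` on
`S¹`, for every `θ ∈ (−π/2, π/2)` and every `x` in the open unit disk with `x − s` and
`d(θ) − s` linearly independent, the vectors `∇ₓφ(x − s, d(θ) − s)` and
`∂_θ ∇ₓφ(x − s, d(θ) − s)` are linearly independent (nonzero `2×2` determinant). -/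
theorem sobolev_geometry_l1 (θ : ℝ) (hθ : θ ∈ Set.Ioo (-(Real.pi / 2)) (Real.pi / 2))
    (x : EuclideanSpace ℝ (Fin 2)) (hx : ‖x‖ < 1)
    (hind : LinearIndependent ℝ ![x - src, det' θ - src]) :
    gradient (fun x' => phi (x' - src) (det' θ - src)) x 0 *
        deriv (fun θ' => gradient (fun x' => phi (x' - src) (det' θ' - src)) x) θ 1 -
      gradient (fun x' => phi (x' - src) (det' θ - src)) x 1 *
        deriv (fun θ' => gradient (fun x' => phi (x' - src) (det' θ' - src)) x) θ 0 ≠ 0 := by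
  obtain ⟨hθ1, hθ2⟩ := hθ
  have hdet : ∀ t, det' t - src = (2 * Real.cos t) • vec2 (Real.cos t) (Real.sin t) := by
    intro t; simp [det']
  simp only [hdet] at hind ⊢
  have hc : 0 < Real.cos θ := Real.cos_pos_of_mem_Ioo ⟨by linarith, by linarith⟩
  have hqne : (x 0 + 1) * Real.sin θ - x 1 * Real.cos θ ≠ 0 := by
    intro h
    rw [LinearIndependent.pair_iff] at hind
    have := hind (2 * Real.cos θ * Real.cos θ) (-(x 0 + 1)) (by
      ext i
      fin_cases i
      · simp [src, vec2_zero_aux]; ring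
      · simp [src, vec2_one_aux]
        linear_combination (-2 * Real.cos θ) * h)
    have h2 := this.1
    have : 0 < 2 * Real.cos θ * Real.cos θ := by positivity
    linarith
  obtain ⟨ε, hε, hq⟩ : ∃ ε : ℝ, (ε = 1 ∨ ε = -1) ∧
      0 < ε * ((x 0 + 1) * Real.sin θ - x 1 * Real.cos θ) := by
    rcases lt_or_gt_of_ne hqne with h | h
    · exact ⟨-1, Or.inr rfl, by linarith⟩
    · exact ⟨1, Or.inl rfl, by linarith⟩
  set u := x 0 + 1 with hu
  set v := x 1 with hv
  have hG : ∀ t, 0 < Real.cos t → 0 < ε * (u * Real.sin t - v * Real.cos t) → _ :=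
    fun t h1 h2 => grad_formula_aux (Real.cos t) (Real.sin t) h1 (Real.cos_sq_add_sin_sq t)
      x ε hε h2
  simp only [← hu, ← hv] at hG
  have hev := (Real.continuous_cos.continuousAt.eventually (lt_mem_nhds hc)).and
    ((show Continuous fun t => ε * (u * Real.sin t - v * Real.cos t) by
      fun_prop).continuousAt.eventually (lt_mem_nhds hq))
  have hev2 := hev.mono (fun t h => hG t h.1 h.2)
  rw [Filter.EventuallyEq.deriv_eq hev2, hG θ hc hq]
  have dc := Real.hasDerivAt_cos θ
  have ds := Real.hasDerivAt_sin θ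
  have dq := (ds.const_mul u).sub (dc.const_mul v)
  have dp := (dc.const_mul u).add (ds.const_mul v)
  have dN := ((dc.const_mul 2).mul dp).sub_const (u ^ 2 + v ^ 2)
  have d0 := (((((dc.const_mul 2).mul dc).sub_const (2 * u)).mul dq).sub (dN.mul ds))
  have d1 := (((((dc.const_mul 2).mul ds).sub_const (2 * v)).mul dq).add (dN.mul dc))
  have hne : 2 * Real.cos θ * (u * Real.sin θ - v * Real.cos θ) ^ 2 ≠ 0 := by positivity
  have dk := (hasDerivAt_const θ ε).div ((dc.const_mul 2).mul (dq.pow 2)) hne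
  have hvec : ∀ {f g : ℝ → ℝ} {f' g' : ℝ}, HasDerivAt f f' θ → HasDerivAt g g' θ →
      HasDerivAt (fun t => vec2 (f t) (g t)) (vec2 f' g') θ := by
    intro f g f' g' hf hg
    have h1 := (hf.smul_const (vec2 1 0)).add (hg.smul_const (vec2 0 1))
    have e : ∀ a b : ℝ, vec2 a b = a • vec2 1 0 + b • vec2 0 1 := by
      intro a b
      ext i
      fin_cases i <;> simp [vec2]
    rw [e f' g']
    refine h1.congr_of_eventuallyEq (Filter.Eventually.of_forall fun t => ?_)
    exact e _ _
  have dG := dk.smul (hvec d0 d1)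
  have hdG := dG.deriv
  have hrw : deriv (fun t => (ε / (2 * Real.cos t * (u * Real.sin t - v * Real.cos t) ^ 2)) •
      vec2 ((2 * Real.cos t * Real.cos t - 2 * u) * (u * Real.sin t - v * Real.cos t)
          - (2 * Real.cos t * (u * Real.cos t + v * Real.sin t) - (u ^ 2 + v ^ 2)) * Real.sin t)
        ((2 * Real.cos t * Real.sin t - 2 * v) * (u * Real.sin t - v * Real.cos t)
          + (2 * Real.cos t * (u * Real.cos t + v * Real.sin t) - (u ^ 2 + v ^ 2)) * Real.cos t)) θ
      = _ := hdG
  rw [hrw]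
  have hx2 : u ^ 2 + v ^ 2 - 2 * u < 0 := by
    have h : ‖x‖ ^ 2 = x 0 ^ 2 + x 1 ^ 2 := by
      rw [EuclideanSpace.norm_sq_eq]
      simp [Fin.sum_univ_two]
    have h2 : ‖x‖ ^ 2 < 1 := by nlinarith [norm_nonneg x]
    have hx0 : x 0 = u - 1 := by rw [hu]; ring
    rw [h, hx0, ← hv] at h2
    nlinarith
  have hupos : 0 < u := by nlinarith [sq_nonneg u, sq_nonneg v]
  simp only [PiLp.add_apply, PiLp.smul_apply, smul_eq_mul, vec2_zero_aux, vec2_one_aux,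
    Pi.mul_apply, Pi.sub_apply, Pi.add_apply, Pi.pow_apply, Pi.div_apply]
  have hcs := Real.sin_sq_add_cos_sq θ
  generalize_proofs
  set c := Real.cos θ
  set s := Real.sin θ
  have hk : (ε / (2 * c * (u * s - v * c) ^ 2)) ≠ 0 := by
    refine div_ne_zero ?_ hne
    rcases hε with h | h <;> simp [h]
  clear_value c s
  set k := ε / (2 * c * (u * s - v * c) ^ 2)
  have hkey : -(k ^ 2 * ((u ^ 2 + v ^ 2) * (u ^ 2 + v ^ 2 - 2 * u))) ≠ 0 := by
    have h1 : 0 < u ^ 2 + v ^ 2 := by positivity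
    exact neg_ne_zero.mpr (mul_ne_zero (pow_ne_zero 2 hk) (mul_ne_zero h1.ne' hx2.ne))
  generalize k = k at *
  intro hzero
  apply hkey
  rw [← hzero]
  linear_combination (k ^ 2 * ((u ^ 2 + v ^ 2) ^ 2
    - 2 * u * (u ^ 2 + v ^ 2) * (s ^ 2 + c ^ 2 + 1))) * hcs
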